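/- Every finite grid complex in ℝ^n is isomorphic, as a cubical complex, to a subcomplex of I^N for some N; that is, there is a bijection between the vertex set of the grid complex and the vertex set of a subcomplex K ⊆ I^N under which a set of vertices is the vertex set of a face of the grid complex if and only if its image is the vertex set of a face of K. -/

import Mathlib

/-- A face of the cube `I^n`: `none` marks a free coordinate. -/
def CubeFace (n : ℕ) : Type := Fin n → Option Bool

namespace CubeFace

/-- The order on faces of the cube: `F ≤ G` iff every coordinate of `G` is free
or agrees with the corresponding coordinate of `F`. -/
instance (n : ℕ) : PartialOrder (CubeFace n) where
  le F G := ∀ i, G i = none ∨ F i = G i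
  le_refl F i := Or.inr rfl
  le_trans F G H h1 h2 i := by
    rcases h2 i with h | h
    · exact Or.inl h
    · rcases h1 i with h' | h'
      · exact Or.inl (h ▸ h')
      · exact Or.inr (h' ▸ h)
  le_antisymm F G h1 h2 := by
    funext i
    rcases h1 i with h | h
    · rcases h2 i with h' | h'
      · rw [h, h']
      · rw [← h', h]
    · exact h

/-- The face of `I^n` corresponding to a vertex. -/
def toFace {n : ℕ} (v : Fin n → Bool) : CubeFace n := fun i => some (v i)

/-- The vertex set of a face. -/
def verts {n : ℕ} (F : CubeFace n) : Set (Fin n → Bool) := {v | toFace v ≤ F}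

/-- The dimension of a face: its number of free coordinates. -/
def dim {n : ℕ} (F : CubeFace n) : ℕ :=
  (@Finset.filter _ (fun i => F i = none) (fun i => decEq (F i) none) Finset.univ).card

/-- A subcomplex of `I^n`: a nonempty, downward closed set of faces. -/
def IsSubcomplex {n : ℕ} (K : Set (CubeFace n)) : Prop :=
  K.Nonempty ∧ ∀ F ∈ K, ∀ G : CubeFace n, G ≤ F → G ∈ K

/-- The vertex set of a subcomplex. -/
def cvert {n : ℕ} (K : Set (CubeFace n)) : Set (Fin n → Bool) := {v | toFace v ∈ K}

/-- A subcomplex `Γ ⊆ K` is face-like if, for every face `F` of `K`, the set of vertices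
of `F` belonging to `Γ` is empty or the vertex set of a face of `Γ`. -/
def FaceLike {n : ℕ} (K Γ : Set (CubeFace n)) : Prop :=
  ∀ F ∈ K, verts F ∩ cvert Γ = ∅ ∨ ∃ G ∈ Γ, verts F ∩ cvert Γ = verts G

/-- The deletion `K ∖ Γ`: the faces of `K` with no vertex in `Γ`. -/
def delete {n : ℕ} (K Γ : Set (CubeFace n)) : Set (CubeFace n) :=
  {F | F ∈ K ∧ verts F ∩ cvert Γ = ∅}

/-- The geometric realization of a subcomplex of `I^n`, as a subset of `ℝ^n`. -/
def real {n : ℕ} (K : Set (CubeFace n)) : Set (Fin n → ℝ) :=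
  ⋃ F ∈ K, {x | (∀ i, 0 ≤ x i ∧ x i ≤ 1) ∧
    ∀ i, (F i = some false → x i = 0) ∧ (F i = some true → x i = 1)}

/-- The boundary `∂F̂` of a face `F`: all faces strictly below `F`. -/
def bdryHat {n : ℕ} (F : CubeFace n) : Set (CubeFace n) := {G | G ≤ F ∧ G ≠ F}

/-- The boundary of the cube `I^k`: all faces except the top one. -/
def boundaryCube (k : ℕ) : Set (CubeFace k) := {F | F ≠ fun _ => none}

/-- The `k`-skeleton of a subcomplex. -/
def skel {n : ℕ} (k : ℕ) (K : Set (CubeFace n)) : Set (CubeFace n) :=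
  {F | F ∈ K ∧ dim F ≤ k}

/-- Isomorphism of cubical subcomplexes: a bijection between the vertex sets under which
vertex sets of faces correspond to vertex sets of faces. -/
def Iso {m n : ℕ} (K : Set (CubeFace m)) (L : Set (CubeFace n)) : Prop :=
  ∃ f : (Fin m → Bool) → (Fin n → Bool),
    Set.BijOn f (cvert K) (cvert L) ∧
    ∀ W : Set (Fin m → Bool), W ⊆ cvert K →
      ((∃ F ∈ K, verts F = W) ↔ (∃ G ∈ L, verts G = f '' W))

/-- `K` has dimension `d`. -/
def HasDim {n : ℕ} (K : Set (CubeFace n)) (d : ℕ) : Prop :=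
  (∀ F ∈ K, dim F ≤ d) ∧ ∃ F ∈ K, dim F = d

end CubeFace

/-- A grid face in `ℝ^n`: a base point `a ∈ ℤ^n` together with a set of free
coordinates. -/
def GridFace (n : ℕ) : Type := (Fin n → ℤ) × Set (Fin n)

/-- The realization of a grid face, as a subset of `ℝ^n`. -/
def gridReal {n : ℕ} (g : GridFace n) : Set (Fin n → ℝ) :=
  {x | ∀ i, (i ∉ g.2 → x i = (g.1 i : ℝ)) ∧
    (i ∈ g.2 → (g.1 i : ℝ) ≤ x i ∧ x i ≤ (g.1 i : ℝ) + 1)}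

/-- The vertex set of a grid face. -/
def gridVerts {n : ℕ} (g : GridFace n) : Set (Fin n → ℤ) :=
  {v | ∀ i, (i ∉ g.2 → v i = g.1 i) ∧ (i ∈ g.2 → v i = g.1 i ∨ v i = g.1 i + 1)}

/-- The vertex set of a set of grid faces. -/
def gridComplexVerts {n : ℕ} (G : Set (GridFace n)) : Set (Fin n → ℤ) :=
  ⋃ g ∈ G, gridVerts g


/-- Threshold map: coordinate `j` compares the `c j`-th entry with `t j`. -/
def thrMap {n N : ℕ} (c : Fin N → Fin n) (t : Fin N → ℤ) (v : Fin n → ℤ) : Fin N → Bool :=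
  fun j => decide (t j < v (c j))

open Classical in
/-- The cube face associated with a grid face under the threshold map. -/
noncomputable def thrFace {n N : ℕ} (c : Fin N → Fin n) (t : Fin N → ℤ) (g : GridFace n) :
    CubeFace N :=
  fun j => if c j ∈ g.2 ∧ t j = g.1 (c j) then none else some (decide (t j < g.1 (c j)))

theorem thrFace_vertex {n N : ℕ} (c : Fin N → Fin n) (t : Fin N → ℤ) (v : Fin n → ℤ) :
    thrFace c t (v, ∅) = CubeFace.toFace (thrMap c t v) := by
  funext j
  simp [thrFace, CubeFace.toFace, thrMap]

open Classical in
theorem thrFace_verts {n N : ℕ} (c : Fin N → Fin n) (t : Fin N → ℤ) (g : GridFace n)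
    (J : Fin n → Fin N) (hJ : ∀ j, t j = g.1 (c j) → J (c j) = j) :
    CubeFace.verts (thrFace c t g) = thrMap c t '' gridVerts g := by
  ext w
  constructor
  · intro hw
    refine ⟨fun i => if i ∈ g.2 ∧ w (J i) = true then g.1 i + 1 else g.1 i, ?_, ?_⟩
    · intro i
      constructor
      · intro hi
        simp [hi]
      · intro hi
        by_cases h : w (J i) = true <;> simp [hi, h]
    · funext j
      have hj : thrFace c t g j = none ∨ some (w j) = thrFace c t g j := hw j
      simp only [thrMap]
      by_cases h : c j ∈ g.2 ∧ t j = g.1 (c j)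
      · have hJj := hJ j h.2
        cases hwj : w j <;> simp [hJj, hwj, h.1, h.2]
      · simp only [thrFace, if_neg h] at hj
        have hj' : w j = decide (t j < g.1 (c j)) := by simpa using hj
        rw [hj', decide_eq_decide]
        split_ifs with h2
        · have : t j ≠ g.1 (c j) := fun h3 => h ⟨h2.1, h3⟩
          omega
        · rfl
  · rintro ⟨v, hv, rfl⟩ j
    by_cases h : c j ∈ g.2 ∧ t j = g.1 (c j)
    · left
      simp only [thrFace, if_pos h]
    · right
      simp only [thrFace, if_neg h, CubeFace.toFace, thrMap, Option.some.injEq, decide_eq_decide]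
      by_cases h2 : c j ∈ g.2
      · have : t j ≠ g.1 (c j) := fun h3 => h ⟨h2, h3⟩
        rcases (hv (c j)).2 h2 with h4 | h4 <;> omega
      · rw [(hv (c j)).1 h2]

open Classical in
theorem thrFace_down {n N : ℕ} (c : Fin N → Fin n) (t : Fin N → ℤ) (g : GridFace n)
    (J : Fin n → Fin N) (hJ : ∀ j, t j = g.1 (c j) → J (c j) = j)
    (F : CubeFace N) (hF : F ≤ thrFace c t g) :
    ∃ g' : GridFace n, gridReal g' ⊆ gridReal g ∧ thrFace c t g' = F := by
  refine ⟨(fun i => if i ∈ g.2 ∧ F (J i) = some true then g.1 i + 1 else g.1 i,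
    {i | i ∈ g.2 ∧ F (J i) = none}), ?_, ?_⟩
  · intro x hx i
    have h := hx i
    simp only [Set.mem_setOf_eq] at h
    by_cases hi : i ∈ g.2
    · refine ⟨fun h' => absurd hi h', fun _ => ?_⟩
      rcases hFi : F (J i) with _ | _ | _
      · simpa [hi, hFi] using h
      · simp [hi, hFi] at h
        constructor <;> linarith
      · simp [hi, hFi] at h
        constructor <;> linarith
    · simp [hi] at h
      simp [hi, h]
  · funext j
    have hj : thrFace c t g j = none ∨ F j = thrFace c t g j := hF j
    by_cases h : c j ∈ g.2 ∧ t j = g.1 (c j)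
    · have hJj := hJ j h.2
      rcases hFj : F j with _ | _ | _ <;> simp [thrFace, hJj, hFj, h.1, h.2]
    · simp only [thrFace, if_neg h] at hj
      have hj' : F j = some (decide (t j < g.1 (c j))) := by simpa using hj
      rw [hj']
      by_cases h2 : c j ∈ g.2
      · have h3 : t j ≠ g.1 (c j) := fun h3 => h ⟨h2, h3⟩
        rcases hFj : F (J (c j)) with _ | _ | _ <;> simp [thrFace, hFj, h2, h3]
        omega
      · simp [thrFace, h2]

theorem gridReal_vertex_subset {n : ℕ} (g : GridFace n) (v : Fin n → ℤ) (hv : v ∈ gridVerts g) :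
    gridReal ((v, ∅) : GridFace n) ⊆ gridReal g := by
  intro x hx i
  have h : x i = (v i : ℝ) := (hx i).1 (by simp)
  rw [h]
  refine ⟨fun hi => by rw [(hv i).1 hi], fun hi => ?_⟩
  rcases (hv i).2 hi with h4 | h4 <;> rw [h4] <;> push_cast <;> constructor <;> linarith

open CubeFace in
/-- every finite grid complex in `ℝ^n` (a finite nonempty set of grid
faces closed under passing to subfaces) is isomorphic, as a cubical complex, to a
subcomplex of `I^N` for some `N`. -/
theorem grid_complex_embeds_into_cube
    {n : ℕ} (G : Set (GridFace n)) (hfin : G.Finite) (hne : G.Nonempty)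
    (hclosed : ∀ g ∈ G, ∀ g' : GridFace n, gridReal g' ⊆ gridReal g → g' ∈ G) :
    ∃ (N : ℕ) (K : Set (CubeFace N)), IsSubcomplex K ∧
      ∃ f : (Fin n → ℤ) → (Fin N → Bool),
        Set.BijOn f (gridComplexVerts G) (cvert K) ∧
        ∀ W : Set (Fin n → ℤ), W ⊆ gridComplexVerts G →
          ((∃ g ∈ G, gridVerts g = W) ↔ (∃ F ∈ K, verts F = f '' W)) := by
  classical
  let P : Set (Fin n × ℤ) := ⋃ g ∈ G, Set.range (fun i => (i, g.1 i))
  have hP : P.Finite := hfin.biUnion (fun g _ => Set.finite_range _)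
  have hmem : ∀ g ∈ G, ∀ i, (i, g.1 i) ∈ P := fun g hg i =>
    Set.mem_biUnion hg ⟨i, rfl⟩
  haveI : Finite P := hP
  obtain ⟨N, ⟨e⟩⟩ := Finite.exists_equiv_fin P
  let c : Fin N → Fin n := fun j => (e.symm j).1.1
  let t : Fin N → ℤ := fun j => (e.symm j).1.2
  have hJex : ∀ g ∈ G, ∃ J : Fin n → Fin N, ∀ j, t j = g.1 (c j) → J (c j) = j := by
    intro g hg
    refine ⟨fun i => e ⟨(i, g.1 i), hmem g hg i⟩, fun j hj => ?_⟩
    rw [← Equiv.eq_symm_apply]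
    exact Subtype.ext (Prod.ext rfl hj.symm)
  have hvG : ∀ v ∈ gridComplexVerts G, ((v, ∅) : GridFace n) ∈ G := by
    intro v hv
    simp only [gridComplexVerts, Set.mem_iUnion] at hv
    obtain ⟨g, hg, hv⟩ := hv
    exact hclosed g hg _ (gridReal_vertex_subset g v hv)
  have hsub : ∀ g ∈ G, gridVerts g ⊆ gridComplexVerts G := fun g hg v hv =>
    Set.mem_biUnion hg hv
  have hlt : ∀ v ∈ gridComplexVerts G, ∀ v', thrMap c t v = thrMap c t v' → ∀ i,
      v' i ≤ v i := by
    intro v hv v' h i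
    have hj := congrFun h (e ⟨(i, v i), hmem _ (hvG v hv) i⟩)
    simp [thrMap, c, t] at hj
    exact hj
  have hinj : Set.InjOn (thrMap c t) (gridComplexVerts G) := by
    intro v hv v' hv' h
    funext i
    exact le_antisymm (hlt v' hv' v h.symm i) (hlt v hv v' h i)
  have hverts : ∀ g ∈ G, verts (thrFace c t g) = thrMap c t '' gridVerts g := by
    intro g hg
    obtain ⟨J, hJ⟩ := hJex g hg
    exact thrFace_verts c t g J hJ
  refine ⟨N, thrFace c t '' G, ⟨hne.image _, ?_⟩, thrMap c t, ⟨?_, hinj, ?_⟩, ?_⟩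
  · rintro _ ⟨g, hg, rfl⟩ F hF
    obtain ⟨J, hJ⟩ := hJex g hg
    obtain ⟨g', h1, h2⟩ := thrFace_down c t g J hJ F hF
    exact ⟨g', hclosed g hg g' h1, h2⟩
  · intro v hv
    exact ⟨(v, ∅), hvG v hv, thrFace_vertex c t v⟩
  · rintro w ⟨g, hg, hw⟩
    have hw' : w ∈ verts (thrFace c t g) := by
      rw [hw]
      exact le_refl (toFace w)
    rw [hverts g hg] at hw'
    exact Set.image_mono (hsub g hg) hw'
  · intro W hW
    constructor
    · rintro ⟨g, hg, rfl⟩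
      exact ⟨_, ⟨g, hg, rfl⟩, hverts g hg⟩
    · rintro ⟨_, ⟨g, hg, rfl⟩, h⟩
      rw [hverts g hg] at h
      exact ⟨g, hg, (hinj.image_eq_image_iff (hsub g hg) hW).1 h⟩
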